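/- Suppose n > 0, λ ∈ ℝ, and f : ℝ → ℝ is a nontrivial C⁴ solution of -λ f' = -(|f|^n f)'''' + f(1-f) with f(y) = 0 for all sufficiently large y, f(y) → 1 as y → -∞, and with all derivatives of |f|^n f tending to 0 at ±∞ and ∫ |f|^n (f')² < ∞. Then λ > 0. -/

import Mathlib

open Real Filter MeasureTheory

lemma qb_pow {p : ℝ → ℝ} {p' y : ℝ} (hp : HasDerivAt p p' y) (hy : 0 < p y) (a b : ℝ) (hb : b = a - 1) :
    HasDerivAt (fun z => p z ^ a) (a * p y ^ b * p') y := by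
  have h := hp.rpow_const (p := a) (Or.inl hy.ne')
  subst hb
  convert h using 1
  ring

noncomputable def qbE (n : ℝ) (f f1 f2 f3 : ℝ → ℝ) (y : ℝ) : ℝ :=
  (n + 1) ^ 2 * ((n ^ 2 / 2 - n) * |f y| ^ (2 * n - 2) * f1 y ^ 4
    + 2 * n * |f y| ^ (2 * n - 2) * f y * f1 y ^ 2 * f2 y
    + |f y| ^ (2 * n) * (f1 y * f3 y - f2 y ^ 2 / 2))

lemma qb_step {F : ℝ → ℝ} {G G' p : ℝ → ℝ} (hp : Continuous p) (k : ℕ)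
    (h : ∀ y, 0 < p y → iteratedDeriv k F y = G y)
    (hG : ∀ y, 0 < p y → HasDerivAt G (G' y) y) :
    (∀ y, 0 < p y → HasDerivAt (iteratedDeriv k F) (G' y) y) ∧
      ∀ y, 0 < p y → iteratedDeriv (k + 1) F y = G' y := by
  have : ∀ y, 0 < p y → HasDerivAt (iteratedDeriv k F) (G' y) y := by
    intro y hy
    refine (hG y hy).congr_of_eventuallyEq ?_
    filter_upwards [hp.continuousAt.eventually (lt_mem_nhds hy)] with z hz
    exact h z hz
  refine ⟨this, fun y hy => ?_⟩
  rw [iteratedDeriv_succ]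
  exact (this y hy).deriv

lemma qb_pos (n s : ℝ) (p p1 p2 p3 p4 F : ℝ → ℝ)
    (h0 : ∀ y, HasDerivAt p (p1 y) y) (h1 : ∀ y, HasDerivAt p1 (p2 y) y)
    (h2 : ∀ y, HasDerivAt p2 (p3 y) y) (h3 : ∀ y, HasDerivAt p3 (p4 y) y)
    (hF : ∀ y, 0 < p y → F y = s * p y ^ (n + 1)) (hs : s ^ 2 = 1) :
    (∀ y, 0 < p y → iteratedDeriv 1 F y = s * ((n + 1) * (p y ^ n * p1 y))) ∧
    (∀ y, 0 < p y → iteratedDeriv 4 F y = s * ((n + 1) *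
      (n * (n - 1) * (n - 2) * p y ^ (n - 3) * p1 y ^ 4
        + 6 * n * (n - 1) * p y ^ (n - 2) * p1 y ^ 2 * p2 y
        + n * p y ^ (n - 1) * (3 * p2 y ^ 2 + 4 * p1 y * p3 y) + p y ^ n * p4 y))) ∧
    (∀ y, 0 < p y → iteratedDeriv 3 F y * iteratedDeriv 1 F y - iteratedDeriv 2 F y ^ 2 / 2
      = qbE n p p1 p2 p3 y) ∧
    (∀ y, 0 < p y → HasDerivAt (qbE n p p1 p2 p3) (iteratedDeriv 4 F y * iteratedDeriv 1 F y) y) := by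
  have hc : Continuous p := continuous_iff_continuousAt.2 fun y => (h0 y).continuousAt
  obtain ⟨d0, e1⟩ := qb_step (F := F) (G := fun y => s * p y ^ (n + 1))
    (G' := fun y => s * ((n + 1) * (p y ^ n * p1 y))) hc 0
    (fun y hy => by simpa using hF y hy) (by
      intro y hy
      exact ((qb_pow (h0 y) hy (n + 1) n (by ring)).const_mul s).congr_deriv (by ring))
  obtain ⟨d1, e2⟩ := qb_step (F := F) 
    (G' := fun y => s * ((n + 1) * (n * p y ^ (n - 1) * p1 y ^ 2 + p y ^ n * p2 y))) hc 1 e1 (by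
      intro y hy
      exact ((((qb_pow (h0 y) hy n (n - 1) (by ring)).mul (h1 y)).const_mul (n + 1)).const_mul s).congr_deriv (by
        try simp only [Pi.pow_apply, Pi.mul_apply, Pi.add_apply]
        push_cast
        ring))
  obtain ⟨d2, e3⟩ := qb_step (F := F) 
    (G' := fun y => s * ((n + 1) * (n * (n - 1) * p y ^ (n - 2) * p1 y ^ 3
        + 3 * n * p y ^ (n - 1) * p1 y * p2 y + p y ^ n * p3 y))) hc 2 e2 (by
      intro y hy
      exact ((((((qb_pow (h0 y) hy (n - 1) (n - 2) (by ring)).const_mul n).mul ((h1 y).pow 2)).add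
        ((qb_pow (h0 y) hy n (n - 1) (by ring)).mul (h2 y))).const_mul (n + 1)).const_mul s).congr_deriv (by
        try simp only [Pi.pow_apply, Pi.mul_apply, Pi.add_apply]
        push_cast
        ring))
  obtain ⟨d3, e4⟩ := qb_step (F := F) 
    (G' := fun y => s * ((n + 1) *
      (n * (n - 1) * (n - 2) * p y ^ (n - 3) * p1 y ^ 4
        + 6 * n * (n - 1) * p y ^ (n - 2) * p1 y ^ 2 * p2 y
        + n * p y ^ (n - 1) * (3 * p2 y ^ 2 + 4 * p1 y * p3 y) + p y ^ n * p4 y))) hc 3 e3 (by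
      intro y hy
      exact (((((((qb_pow (h0 y) hy (n - 2) (n - 3) (by ring)).const_mul (n * (n - 1))).mul
        ((h1 y).pow 3)).add
        ((((qb_pow (h0 y) hy (n - 1) (n - 2) (by ring)).const_mul (3 * n)).mul (h1 y)).mul (h2 y))).add
        ((qb_pow (h0 y) hy n (n - 1) (by ring)).mul (h3 y))).const_mul (n + 1)).const_mul s).congr_deriv (by
        try simp only [Pi.pow_apply, Pi.mul_apply, Pi.add_apply]
        push_cast
        ring))
  have hE : ∀ y, 0 < p y → iteratedDeriv 3 F y * iteratedDeriv 1 F y - iteratedDeriv 2 F y ^ 2 / 2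
      = qbE n p p1 p2 p3 y := by
    intro y hy
    rw [e1 y hy, e2 y hy, e3 y hy]
    unfold qbE
    have a1 : p y ^ (n - 1) = p y ^ n / p y := by rw [rpow_sub hy, rpow_one]
    have a2 : p y ^ (n - 2) = p y ^ n / p y ^ 2 := by rw [rpow_sub hy, rpow_two]
    have a4 : p y ^ (2 * n) = (p y ^ n) ^ 2 := by rw [mul_comm, rpow_mul hy.le, rpow_two]
    have a3 : p y ^ (2 * n - 2) = (p y ^ n) ^ 2 / p y ^ 2 := by rw [rpow_sub hy, rpow_two, a4]
    rw [abs_of_pos hy, a1, a2, a3, a4]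
    generalize p y ^ n = q
    have hy' := hy.ne'
    field_simp
    linear_combination (n + 1) ^ 2 * (2 * q ^ 2 * p1 y * (n*(n-1) * p1 y ^ 3 + 3 * n * p y * p1 y * p2 y + p y ^ 2 * p3 y)
      - q ^ 2 * (n * p1 y ^ 2 + p y * p2 y) ^ 2) * hs
  refine ⟨e1, e4, hE, fun y hy => ?_⟩
  have h := ((d3 y hy).mul (d1 y hy)).sub (((d2 y hy).pow 2).div_const 2)
  refine HasDerivAt.congr_deriv (h.congr_of_eventuallyEq ?_) ?_
  · filter_upwards [hc.continuousAt.eventually (lt_mem_nhds hy)] with z hz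
    exact (hE z hz).symm
  · rw [← e2 y hy, ← e3 y hy, ← e4 y hy]
    simp
    ring

lemma qb_final (c lam A : ℝ) (hA : 0 < A) (S : Set ℝ) (hS : S.Countable) (H g : ℝ → ℝ)
    (hH : ContinuousOn H (Set.Iio c)) (hg : Continuous g) (hg0 : ∀ y, 0 ≤ g y)
    (hd : ∀ y, y < c → y ∉ S → HasDerivAt H (lam * g y) y)
    (hbot : Tendsto H atBot (nhds (-A))) (l : Filter ℝ) [l.NeBot] (hl : l ≤ nhdsWithin c (Set.Iio c))
    (hlim : Tendsto H l (nhds 0)) : 0 < lam := by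
  by_contra hlam
  push Not at hlam
  have hanti : ∀ a b, a ≤ b → b < c → H b ≤ H a := by
    intro a b hab hb
    have h := integral_eq_of_hasDerivAt_off_countable_of_le H (fun y => lam * g y) hab hS
      (hH.mono fun z hz => lt_of_le_of_lt hz.2 hb)
      (fun z hz => hd z (hz.1.2.trans hb) hz.2)
      ((continuous_const.mul hg).intervalIntegrable _ _)
    have h2 : ∫ x in a..b, lam * g x ≤ 0 := by
      rw [intervalIntegral.integral_const_mul]
      exact mul_nonpos_of_nonpos_of_nonneg hlam
        (intervalIntegral.integral_nonneg hab fun z _ => hg0 z)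
    linarith
  have h1 : ∀ b, b < c → H b ≤ -A := fun b hb =>
    ge_of_tendsto hbot ((eventually_le_atBot b).mono fun a ha => hanti a b ha hb)
  have h2 : (0 : ℝ) ≤ -A := le_of_tendsto hlim
    (Filter.Eventually.mono (hl self_mem_nhdsWithin : ∀ᶠ z in l, z < c) fun z hz => h1 z hz)
  linarith

noncomputable def qbPhi (n s : ℝ) : ℝ :=
  (n + 1) * (|s| ^ (n + 2) / (n + 2) - |s| ^ (n + 2) * s / (n + 3))

lemma qb_phi_deriv (n : ℝ) (hn : 0 < n) (s : ℝ) :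
    HasDerivAt (qbPhi n) ((n + 1) * |s| ^ n * (s * (1 - s))) s := by
  have h := hasDerivAt_abs_rpow s (p := n + 2) (by linarith)
  have h2 := ((h.div_const (n + 2)).sub ((h.mul (hasDerivAt_id s)).div_const (n + 3))).const_mul (n + 1)
  refine h2.congr_deriv ?_
  have e : |s| ^ (n + 2) = |s| ^ n * s ^ 2 := by
    rw [rpow_add_of_nonneg (abs_nonneg s) hn.le (by norm_num), rpow_two, sq_abs]
  have e2 : n + 2 - 2 = n := by ring
  rw [e2, e]
  have : n + 2 ≠ 0 := by linarith
  have : n + 3 ≠ 0 := by linarith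
  simp
  field_simp
  ring

lemma qb_phi_zero (n : ℝ) (hn : 0 < n) : qbPhi n 0 = 0 := by
  unfold qbPhi
  rw [abs_zero, zero_rpow (by linarith)]
  simp

lemma qb_phi_one (n : ℝ) (hn : 0 < n) : 0 < qbPhi n 1 := by
  unfold qbPhi
  rw [abs_one, one_rpow]
  have : 1 / (n + 3) < 1 / (n + 2) := one_div_lt_one_div_of_lt (by linarith) (by linarith)
  have h : 0 < 1 / (n + 2) - 1 * 1 / (n + 3) := by simpa using this
  positivity

lemma qb_countable (f f1 : ℝ → ℝ) (h0 : ∀ y, HasDerivAt f (f1 y) y) :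
    {y | f y = 0 ∧ f1 y ≠ 0}.Countable := by
  refine (countable_setOfPred_isolated_right_within (s := {y | f y = 0 ∧ f1 y ≠ 0})).mono ?_
  intro y hy
  refine ⟨hy, ?_⟩
  have h := (h0 y).eventually_ne (c := 0) hy.2
  rw [← Filter.empty_mem_iff_bot]
  have h2 : ∀ᶠ z in nhdsWithin y ({y | f y = 0 ∧ f1 y ≠ 0} ∩ Set.Ioi y), f z ≠ 0 :=
    h.filter_mono (nhdsWithin_mono _ fun z hz => (ne_of_gt hz.2 : z ≠ y))
  filter_upwards [h2, self_mem_nhdsWithin] with z hz hz2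
  exact hz hz2.1.1

lemma qb_ne (n : ℝ) (f f1 f2 f3 f4 F : ℝ → ℝ)
    (h0 : ∀ y, HasDerivAt f (f1 y) y) (h1 : ∀ y, HasDerivAt f1 (f2 y) y)
    (h2 : ∀ y, HasDerivAt f2 (f3 y) y) (h3 : ∀ y, HasDerivAt f3 (f4 y) y)
    (hF : ∀ y, F y = |f y| ^ n * f y) (y : ℝ) (hy : f y ≠ 0) :
    HasDerivAt (qbE n f f1 f2 f3) (iteratedDeriv 4 F y * ((n + 1) * (|f y| ^ n * f1 y))) y := by
  rcases lt_or_gt_of_ne hy with hy | hy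
  · obtain ⟨a, b, c, d⟩ := qb_pos n (-1) (fun z => -f z) (fun z => -f1 z) (fun z => -f2 z) (fun z => -f3 z)
      (fun z => -f4 z) F (fun z => (h0 z).neg) (fun z => (h1 z).neg) (fun z => (h2 z).neg)
      (fun z => (h3 z).neg) (by
        intro z hz
        rw [hF, rpow_add hz, rpow_one, abs_of_neg (by linarith : f z < 0)]
        ring) (by norm_num)
    have hy' : 0 < -f y := by linarith
    have e : qbE n (fun z => -f z) (fun z => -f1 z) (fun z => -f2 z) (fun z => -f3 z)
        = qbE n f f1 f2 f3 := by
      funext z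
      simp only [qbE, abs_neg]
      ring
    have := d y hy'
    rw [e, a y hy'] at this
    refine this.congr_deriv ?_
    rw [abs_of_neg hy]
    ring
  · obtain ⟨a, b, c, d⟩ := qb_pos n 1 f f1 f2 f3 f4 F h0 h1 h2 h3 (by
        intro z hz
        rw [hF, rpow_add hz, rpow_one, abs_of_pos hz]
        ring) (by norm_num)
    have := d y hy
    rw [a y hy] at this
    refine this.congr_deriv ?_
    rw [abs_of_pos hy]
    ring

lemma qb_H (n lam : ℝ) (hn : 0 < n) (f f1 f2 f3 f4 F : ℝ → ℝ)
    (h0 : ∀ y, HasDerivAt f (f1 y) y) (h1 : ∀ y, HasDerivAt f1 (f2 y) y)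
    (h2 : ∀ y, HasDerivAt f2 (f3 y) y) (h3 : ∀ y, HasDerivAt f3 (f4 y) y)
    (hF : ∀ y, F y = |f y| ^ n * f y)
    (hode : ∀ y, iteratedDeriv 4 F y = lam * f1 y + f y * (1 - f y)) (y : ℝ) (hy : f y ≠ 0) :
    HasDerivAt (fun z => qbE n f f1 f2 f3 z - qbPhi n (f z))
      (lam * ((n + 1) * (|f y| ^ n * f1 y ^ 2))) y := by
  have a := qb_ne n f f1 f2 f3 f4 F h0 h1 h2 h3 hF y hy
  have b := (qb_phi_deriv n hn (f y)).comp y (h0 y)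
  refine (a.sub b).congr_deriv ?_
  rw [hode]
  ring

lemma qb_case1 (n lam : ℝ) (hn : 1 ≤ n) (f f1 f2 f3 f4 F : ℝ → ℝ)
    (h0 : ∀ y, HasDerivAt f (f1 y) y) (h1 : ∀ y, HasDerivAt f1 (f2 y) y)
    (h2 : ∀ y, HasDerivAt f2 (f3 y) y) (h3 : ∀ y, HasDerivAt f3 (f4 y) y)
    (hF : ∀ y, F y = |f y| ^ n * f y)
    (hode : ∀ y, iteratedDeriv 4 F y = lam * f1 y + f y * (1 - f y))
    (hright : ∃ Y : ℝ, ∀ y ≥ Y, f y = 0)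
    (hleft : Tendsto f atBot (nhds 1))
    (hH : Tendsto (fun z => qbE n f f1 f2 f3 z - qbPhi n (f z)) atBot (nhds (-qbPhi n 1))) :
    0 < lam := by
  have hn0 : 0 < n := by linarith
  have c0 : Continuous f := continuous_iff_continuousAt.2 fun y => (h0 y).continuousAt
  have c1 : Continuous f1 := continuous_iff_continuousAt.2 fun y => (h1 y).continuousAt
  have c2 : Continuous f2 := continuous_iff_continuousAt.2 fun y => (h2 y).continuousAt
  have c3 : Continuous f3 := continuous_iff_continuousAt.2 fun y => (h3 y).continuousAt
  have cphi : Continuous (qbPhi n) :=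
    continuous_iff_continuousAt.2 fun y => (qb_phi_deriv n hn0 y).continuousAt
  have cE : Continuous (qbE n f f1 f2 f3) := by
    have e1 : Continuous fun y => |f y| ^ (2 * n - 2) := c0.abs.rpow_const fun _ => Or.inr (by linarith)
    have e2 : Continuous fun y => |f y| ^ (2 * n) := c0.abs.rpow_const fun _ => Or.inr (by linarith)
    unfold qbE
    fun_prop
  have cn : Continuous fun y => |f y| ^ n := c0.abs.rpow_const fun _ => Or.inr (by linarith)
  set T : Set ℝ := {y | f y = 0 ∧ f1 y = 0} with hT
  have hTc : IsClosed T := (isClosed_eq c0 continuous_const).inter (isClosed_eq c1 continuous_const)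
  have hTn : T.Nonempty := by
    obtain ⟨Y, hY⟩ := hright
    refine ⟨Y + 1, hY _ (by linarith), ?_⟩
    have : HasDerivAt f 0 (Y + 1) := by
      refine (hasDerivAt_const (Y + 1) (0 : ℝ)).congr_of_eventuallyEq ?_
      filter_upwards [lt_mem_nhds (show Y < Y + 1 by linarith)] with z hz
      exact hY z hz.le
    exact (h0 _).unique this
  have hTb : BddBelow T := by
    obtain ⟨a, ha⟩ := eventually_atBot.1 (hleft.eventually (lt_mem_nhds (show (0 : ℝ) < 1 by norm_num)))
    refine ⟨a, fun z hz => ?_⟩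
    by_contra hza
    have := ha z (by linarith)
    rw [hz.1] at this
    exact lt_irrefl _ this
  have hc := hTc.csInf_mem hTn hTb
  set c := sInf T
  refine qb_final c lam (qbPhi n 1) (qb_phi_one n hn0) _ (qb_countable f f1 h0)
    (fun z => qbE n f f1 f2 f3 z - qbPhi n (f z)) (fun y => (n + 1) * (|f y| ^ n * f1 y ^ 2))
    (by fun_prop) (by fun_prop) (fun y => by positivity) ?_ hH (nhdsWithin c (Set.Iio c)) le_rfl ?_
  · intro y hy hyS
    refine qb_H n lam hn0 f f1 f2 f3 f4 F h0 h1 h2 h3 hF hode y fun h => ?_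
    have : y ∈ T := ⟨h, by_contra fun h' => hyS ⟨h, h'⟩⟩
    exact absurd (csInf_le hTb this) (not_le.2 hy)
  · have hcont : Continuous (fun z => qbE n f f1 f2 f3 z - qbPhi n (f z)) := by fun_prop
    have := hcont.tendsto c
    have e : qbE n f f1 f2 f3 c - qbPhi n (f c) = 0 := by
      rw [hc.1, qb_phi_zero n hn0, qbE, hc.1, hc.2, abs_zero, zero_rpow (x := 2 * n) (by linarith)]
      ring
    rw [e] at this
    exact this.mono_left nhdsWithin_le_nhds

lemma qb_case2 (n lam : ℝ) (hn0 : 0 < n) (hn : n < 1) (f f1 f2 f3 f4 F : ℝ → ℝ)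
    (h0 : ∀ y, HasDerivAt f (f1 y) y) (h1 : ∀ y, HasDerivAt f1 (f2 y) y)
    (h2 : ∀ y, HasDerivAt f2 (f3 y) y) (h3 : ∀ y, HasDerivAt f3 (f4 y) y) (c4 : Continuous f4)
    (hF : ∀ y, F y = |f y| ^ n * f y)
    (hode : ∀ y, iteratedDeriv 4 F y = lam * f1 y + f y * (1 - f y))
    (hright : ∃ Y : ℝ, ∀ y ≥ Y, f y = 0)
    (hleft : Tendsto f atBot (nhds 1))
    (hH : Tendsto (fun z => qbE n f f1 f2 f3 z - qbPhi n (f z)) atBot (nhds (-qbPhi n 1))) :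
    0 < lam := by
  have c0 : Continuous f := continuous_iff_continuousAt.2 fun y => (h0 y).continuousAt
  have c1 : Continuous f1 := continuous_iff_continuousAt.2 fun y => (h1 y).continuousAt
  have c2 : Continuous f2 := continuous_iff_continuousAt.2 fun y => (h2 y).continuousAt
  have c3 : Continuous f3 := continuous_iff_continuousAt.2 fun y => (h3 y).continuousAt
  have cphi : Continuous (qbPhi n) :=
    continuous_iff_continuousAt.2 fun y => (qb_phi_deriv n hn0 y).continuousAt
  have cn : Continuous fun y => |f y| ^ n := c0.abs.rpow_const fun _ => Or.inr (by linarith)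
  obtain ⟨a, ha⟩ := eventually_atBot.1 (hleft.eventually (lt_mem_nhds (show (0 : ℝ) < 1 by norm_num)))
  set T : Set ℝ := {y | f y = 0} with hT
  have hTc : IsClosed T := isClosed_eq c0 continuous_const
  have hTn : T.Nonempty := by
    obtain ⟨Y, hY⟩ := hright
    exact ⟨Y, hY _ le_rfl⟩
  have hTb : BddBelow T := by
    refine ⟨a, fun z hz => ?_⟩
    by_contra hza
    have := ha z (by linarith)
    rw [show f z = 0 from hz] at this
    exact lt_irrefl _ this
  have hc : f (sInf T) = 0 := hTc.csInf_mem hTn hTb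
  have hlt : ∀ y, y < sInf T → f y ≠ 0 := fun y hy h =>
    absurd (csInf_le hTb h) (not_le.2 hy)
  generalize sInf T = c at hc hlt
  have hac : a < c := by
    by_contra h
    have := ha c (by linarith)
    linarith
  have hpos : ∀ y, y < c → 0 < f y := by
    intro y hy
    by_contra hneg
    have hm : min a y < c := min_lt_of_left_lt hac
    obtain ⟨z, hz, hz0⟩ := intermediate_value_Icc' (min_le_right a y) c0.continuousOn
      ⟨not_lt.1 hneg, (ha (min a y) (min_le_left _ _)).le⟩
    exact hlt z (hz.2.trans_lt hy) hz0
  have ev : ∀ᶠ z in nhdsWithin c (Set.Iio c), z < c := self_mem_nhdsWithin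
  -- the first zero is not transversal
  have hf1 : f1 c = 0 := by
    obtain ⟨_, b, _, _⟩ := qb_pos n 1 f f1 f2 f3 f4 F h0 h1 h2 h3 (by
        intro z hz
        rw [hF, rpow_add hz, rpow_one, abs_of_pos hz]
        ring) (by norm_num)
    have cL : Continuous fun y => f y ^ (3 - n) * (lam * f1 y + f y * (1 - f y)) := by
      have : Continuous fun y => f y ^ (3 - n) := c0.rpow_const fun _ => Or.inr (by linarith)
      fun_prop
    have cR : Continuous fun y => (n + 1) * (n * (n - 1) * (n - 2) * f1 y ^ 4
        + 6 * n * (n - 1) * f y * f1 y ^ 2 * f2 y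
        + n * f y ^ 2 * (3 * f2 y ^ 2 + 4 * f1 y * f3 y) + f y ^ 3 * f4 y) := by fun_prop
    have heq := tendsto_nhds_unique_of_eventuallyEq
      ((cL.tendsto c).mono_left (nhdsWithin_le_nhds (s := Set.Iio c)))
      ((cR.tendsto c).mono_left (nhdsWithin_le_nhds (s := Set.Iio c))) (by
        filter_upwards [ev] with y hy
        have hy := hpos y hy
        rw [← hode y, b y hy]
        have a0 : f y ^ (3 - n) = f y ^ 3 / f y ^ n := by
          rw [rpow_sub hy]; norm_cast
        have a1 : f y ^ (n - 1) = f y ^ n / f y := by rw [rpow_sub hy, rpow_one]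
        have a2 : f y ^ (n - 2) = f y ^ n / f y ^ 2 := by rw [rpow_sub hy, rpow_two]
        have a3 : f y ^ (n - 3) = f y ^ n / f y ^ 3 := by
          rw [rpow_sub hy]; norm_cast
        rw [a0, a1, a2, a3]
        have : f y ^ n ≠ 0 := (rpow_pos_of_pos hy n).ne'
        generalize f y ^ n = q at *
        have := hy.ne'
        field_simp)
    simp only [hc] at heq
    rw [zero_rpow (by linarith)] at heq
    have h4 : (n + 1) * (n * (n - 1) * (n - 2)) * f1 c ^ 4 = 0 := by linear_combination -heq
    have hne : (n + 1) * (n * (n - 1) * (n - 2)) ≠ 0 := by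
      refine mul_ne_zero (by linarith) (mul_ne_zero (mul_ne_zero hn0.ne' ?_) ?_) <;> linarith
    exact pow_eq_zero_iff (by norm_num) |>.1 ((mul_eq_zero.1 h4).resolve_left hne)
  -- local bounds
  obtain ⟨M0, hM0⟩ := (isCompact_Icc (a := c - 1) (b := c)).exists_bound_of_continuousOn c2.continuousOn
  obtain ⟨K, hK⟩ := (isCompact_Icc (a := c - 1) (b := c)).exists_bound_of_continuousOn
    (f := fun y => f1 y * f3 y - f2 y ^ 2 / 2) (by fun_prop)
  obtain ⟨M, hMpos, hM⟩ : ∃ M > 0, ∀ y ∈ Set.Icc (c - 1) c, |f2 y| ≤ M :=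
    ⟨max M0 1, by positivity, fun y hy => (hM0 y hy).trans (le_max_left _ _)⟩
  have hlip : ∀ y z, c - 1 ≤ y → y < z → z ≤ c → f1 z - f1 y ≤ M * (z - y) := by
    intro y z hy hyz hz
    obtain ⟨x, hx, hxe⟩ := exists_hasDerivAt_eq_slope f1 f2 hyz c1.continuousOn fun x _ => h1 x
    have := (abs_le.1 (hM x ⟨by linarith [hx.1], by linarith [hx.2]⟩)).2
    rw [hxe, div_le_iff₀ (by linarith)] at this
    exact this
  have hsq : ∀ y, c - 1 < y → y < c → f1 y < 0 → f1 y ^ 2 ≤ 4 * M * f y := by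
    intro y hy hyc hneg
    have hh := hlip y c hy.le hyc le_rfl
    rw [hf1] at hh
    set h := -f1 y / (2 * M) with hhdef
    have hfe : f1 y = -(2 * M * h) := by rw [hhdef]; field_simp
    have hhpos : 0 < h := by rw [hhdef]; apply div_pos <;> linarith
    have hle : y + h ≤ c := by
      rw [hfe] at hh
      have : M * (2 * h) ≤ M * (c - y) := by linarith
      have := le_of_mul_le_mul_left this hMpos
      linarith
    have hnn : 0 ≤ f (y + h) := by
      rcases hle.lt_or_eq with h' | h'
      · exact (hpos _ h').le
      · rw [h', hc]
    obtain ⟨x, hx, hxe⟩ := exists_hasDerivAt_eq_slope f f1 (show y < y + h by linarith)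
      c0.continuousOn fun x _ => h0 x
    have h5 := hlip y x hy.le hx.1 (by linarith [hx.2])
    have h6 : f1 x ≤ f1 y + M * h := by
      have : M * (x - y) ≤ M * h := mul_le_mul_of_nonneg_left (by linarith [hx.2]) hMpos.le
      linarith
    have h7 : f (y + h) - f y = h * f1 x := by
      rw [hxe, add_sub_cancel_left]
      exact (mul_div_cancel₀ _ hhpos.ne').symm
    have h8 : h * f1 x ≤ h * (f1 y + M * h) := mul_le_mul_of_nonneg_left h6 hhpos.le
    rw [hfe] at h8 ⊢
    have h9 : M * h ^ 2 ≤ f y := by nlinarith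
    nlinarith
  -- the filter
  set l := nhdsWithin c (Set.Iio c) ⊓ 𝓟 {y | f1 y < 0} with hl
  have hlne : l.NeBot := by
    rw [hl, ← Filter.frequently_mem_iff_neBot]
    rw [Filter.frequently_iff]
    intro U hU
    obtain ⟨w, hw, hwU⟩ := (mem_nhdsLT_iff_exists_Ioo_subset (a := c)).1 hU
    obtain ⟨x, hx, hxe⟩ := exists_hasDerivAt_eq_slope f f1 hw c0.continuousOn fun x _ => h0 x
    refine ⟨x, hwU hx, ?_⟩
    show f1 x < 0
    rw [hxe, hc]
    exact div_neg_of_neg_of_pos (by linarith [hpos w hw]) (by linarith [show w < c from hw])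
  have hHd := qb_H n lam hn0 f f1 f2 f3 f4 F h0 h1 h2 h3 hF hode
  have hlc : l ≤ nhds c := inf_le_left.trans nhdsWithin_le_nhds
  refine qb_final c lam (qbPhi n 1) (qb_phi_one n hn0) ∅ Set.countable_empty
    (fun z => qbE n f f1 f2 f3 z - qbPhi n (f z)) (fun y => (n + 1) * (|f y| ^ n * f1 y ^ 2))
    (fun y hy => (hHd y (hlt y hy)).continuousAt.continuousWithinAt)
    (by fun_prop) (fun y => by positivity) (fun y hy _ => hHd y (hlt y hy)) hH l inf_le_left ?_
  have hphi : Tendsto (fun z => qbPhi n (f z)) l (nhds 0) := by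
    have := (cphi.comp c0).tendsto c
    simp only [Function.comp, hc, qb_phi_zero n hn0] at this
    exact this.mono_left hlc
  have hE : Tendsto (qbE n f f1 f2 f3) l (nhds 0) := by
    set C := (n + 1) ^ 2 * (|n ^ 2 / 2 - n| * (4 * M) ^ 2 + 2 * n * (4 * M) * M + K) with hC
    have cb : Continuous fun y => C * |f y| ^ (2 * n) := by
      have : Continuous fun y => |f y| ^ (2 * n) := c0.abs.rpow_const fun _ => Or.inr (by linarith)
      fun_prop
    have tb := cb.tendsto c
    simp only [hc, abs_zero] at tb
    rw [zero_rpow (by linarith), mul_zero] at tb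
    refine squeeze_zero_norm' ?_ (tb.mono_left hlc)
    have e1 : ∀ᶠ z in l, z < c := ev.filter_mono inf_le_left
    have e2 : ∀ᶠ z in l, c - 1 < z := (lt_mem_nhds (show c - 1 < c by linarith)).filter_mono hlc
    have e3 : ∀ᶠ z in l, f1 z < 0 := by
      have : {y | f1 y < 0} ∈ l := mem_inf_of_right (mem_principal_self _)
      exact this
    filter_upwards [e1, e2, e3] with y hy1 hy2 hy3
    have hy := hpos y hy1
    have hmem : y ∈ Set.Icc (c - 1) c := ⟨hy2.le, hy1.le⟩
    have hs := hsq y hy2 hy1 hy3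
    set r := f1 y ^ 2 / f y with hr
    have hr1 : r ≤ 4 * M := by rw [hr, div_le_iff₀ hy]; exact hs
    have hr0 : 0 ≤ r := by positivity
    have hEe : qbE n f f1 f2 f3 y = (n + 1) ^ 2 * ((n ^ 2 / 2 - n) * r ^ 2 + 2 * n * r * f2 y
        + (f1 y * f3 y - f2 y ^ 2 / 2)) * |f y| ^ (2 * n) := by
      unfold qbE
      rw [abs_of_pos hy, rpow_sub hy, rpow_two, hr]
      field_simp
    rw [hEe, norm_mul, norm_of_nonneg (by positivity : 0 ≤ |f y| ^ (2 * n)), norm_mul,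
      norm_of_nonneg (by positivity : 0 ≤ (n + 1) ^ 2), hC]
    have hk := hK y hmem
    have hm := hM y hmem
    gcongr
    refine (norm_add₃_le).trans ?_
    gcongr
    · rw [norm_mul, norm_pow, norm_of_nonneg hr0, Real.norm_eq_abs]
      gcongr
    · rw [norm_mul, norm_of_nonneg (by positivity : 0 ≤ 2 * n * r), Real.norm_eq_abs]
      gcongr
  simpa using hE.sub hphi

theorem quasilinear_biharmonic_speed_positive
    (n lam : ℝ) (hn : 0 < n) (f : ℝ → ℝ) (hf : ContDiff ℝ 4 f)
    (F : ℝ → ℝ) (hF : ∀ y, F y = |f y| ^ n * f y)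
    (hnontriv : ∃ y, f y ≠ 0)
    (hode : ∀ y, -lam * deriv f y = -(iteratedDeriv 4 F y) + f y * (1 - f y))
    (hright : ∃ Y : ℝ, ∀ y ≥ Y, f y = 0)
    (hleft : Tendsto f atBot (nhds 1))
    (hderivBot : ∀ k : ℕ, 1 ≤ k → k ≤ 4 → Tendsto (iteratedDeriv k F) atBot (nhds 0))
    (hderivTop : ∀ k : ℕ, 1 ≤ k → k ≤ 4 → Tendsto (iteratedDeriv k F) atTop (nhds 0))
    (hint : Integrable (fun y => |f y| ^ n * (deriv f y) ^ 2)) :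
    0 < lam := by
  have hD : ∀ k : ℕ, k < 4 → ∀ y, HasDerivAt (iteratedDeriv k f) (iteratedDeriv (k + 1) f y) y := by
    intro k hk y
    rw [iteratedDeriv_succ]
    exact (hf.differentiable_iteratedDeriv k (by exact_mod_cast hk) y).hasDerivAt
  have h0 : ∀ y, HasDerivAt f (iteratedDeriv 1 f y) y := by
    simpa using hD 0 (by norm_num)
  have h1 := hD 1 (by norm_num)
  have h2 := hD 2 (by norm_num)
  have h3 := hD 3 (by norm_num)
  have c4 : Continuous (iteratedDeriv 4 f) := hf.continuous_iteratedDeriv 4 (by norm_num)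
  have hode' : ∀ y, iteratedDeriv 4 F y = lam * iteratedDeriv 1 f y + f y * (1 - f y) := by
    intro y
    rw [iteratedDeriv_one]
    linarith [hode y]
  obtain ⟨_, _, c, _⟩ := qb_pos n 1 f _ _ _ _ F h0 h1 h2 h3 (by
        intro z hz
        rw [hF, rpow_add hz, rpow_one, abs_of_pos hz]
        ring) (by norm_num)
  have hE : Tendsto (qbE n f (iteratedDeriv 1 f) (iteratedDeriv 2 f) (iteratedDeriv 3 f)) atBot
      (nhds 0) := by
    have t := ((hderivBot 3 (by norm_num) (by norm_num)).mul
      (hderivBot 1 (by norm_num) (by norm_num))).sub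
      (((hderivBot 2 (by norm_num) (by norm_num)).pow 2).div_const 2)
    have t' : Tendsto (fun y => iteratedDeriv 3 F y * iteratedDeriv 1 F y
        - iteratedDeriv 2 F y ^ 2 / 2) atBot (nhds 0) := by simpa using t
    refine t'.congr' ?_
    filter_upwards [hleft.eventually (lt_mem_nhds (show (0 : ℝ) < 1 by norm_num))] with y hy
    exact c y hy
  have hH : Tendsto (fun z => qbE n f (iteratedDeriv 1 f) (iteratedDeriv 2 f) (iteratedDeriv 3 f) z
      - qbPhi n (f z)) atBot (nhds (-qbPhi n 1)) := by
    have := hE.sub ((qb_phi_deriv n hn 1).continuousAt.tendsto.comp hleft)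
    simpa using this
  rcases le_or_gt 1 n with h | h
  · exact qb_case1 n lam h f _ _ _ _ F h0 h1 h2 h3 hF hode' hright hleft hH
  · exact qb_case2 n lam hn h f _ _ _ _ F h0 h1 h2 h3 c4 hF hode' hright hleft hH
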